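/- arXiv:1206.5515 — 2 statements merged into one kernel-verified Lean document; each statement's English description precedes it below -/
import Mathlib

section
/- If ν ∈ P₂(ℝⁿ) is absolutely continuous with respect to Lebesgue measure, then the function μ ↦ W₂²(ν, μ) is strictly convex on P₂(ℝⁿ) with respect to the linear structure: for μ₀ ≠ μ₁ in P₂(ℝⁿ) and s ∈ (0,1), W₂²(ν, sμ₁+(1−s)μ₀) < s·W₂²(ν, μ₁) + (1−s)·W₂²(ν, μ₀). -/
open MeasureTheory Set

noncomputable section

/-- `ℝⁿ` with the Euclidean norm. -/
abbrev En (n : ℕ) := EuclideanSpace ℝ (Fin n)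

/-- `γ` is a coupling of `μ` and `ν`. -/
def IsCoupling {n : ℕ} (γ : Measure (En n × En n)) (μ ν : Measure (En n)) : Prop :=
  γ.map Prod.fst = μ ∧ γ.map Prod.snd = ν

/-- The squared quadratic Wasserstein distance `W₂²(μ,ν)`. -/
def W2sq {n : ℕ} (μ ν : Measure (En n)) : ℝ :=
  sInf { c | ∃ γ : Measure (En n × En n), IsCoupling γ μ ν ∧ c = ∫ p, ‖p.1 - p.2‖ ^ 2 ∂γ }

/-- `μ` has finite second moment. -/
def FinSecMom {n : ℕ} (μ : Measure (En n)) : Prop := Integrable (fun x => ‖x‖ ^ 2) μ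

/-- The curve `t ↦ μ t` is weakly continuous on `s`. -/
def WeakContOn {n : ℕ} (μ : ℝ → Measure (En n)) (s : Set ℝ) : Prop :=
  ∀ f : BoundedContinuousFunction (En n) ℝ, ContinuousOn (fun t => ∫ x, f x ∂(μ t)) s

/-- `μb` is a barycenter of the curve `t ↦ μ t`, `t ∈ [0,1]`: it minimizes
`ν ↦ ∫₀¹ W₂²(μ_t, ν) dt` over probability measures with finite second moment. -/
def IsBarycenter {n : ℕ} (μ : ℝ → Measure (En n)) (μb : Measure (En n)) : Prop :=
  IsProbabilityMeasure μb ∧ FinSecMom μb ∧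
    ∀ ν : Measure (En n), IsProbabilityMeasure ν → FinSecMom ν →
      ∫ t in Icc (0:ℝ) 1, W2sq (μ t) μb ≤ ∫ t in Icc (0:ℝ) 1, W2sq (μ t) ν

open scoped RealInnerProductSpace NNReal ENNReal Topology

/-- A set of pairs is monotone if `⟪x - x', y - y'⟫ ≥ 0` for all its members `(x, y)`, `(x', y')`. -/
def IsMonotoneSet {E : Type*} [NormedAddCommGroup E] [InnerProductSpace ℝ E]
    (M : Set (E × E)) : Prop :=
  ∀ p ∈ M, ∀ q ∈ M, 0 ≤ ⟪p.1 - q.1, p.2 - q.2⟫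

section MonotoneSet

variable {E : Type*} [NormedAddCommGroup E] [InnerProductSpace ℝ E] {M : Set (E × E)}

lemma IsMonotoneSet.exists_maximal (hM : IsMonotoneSet M) :
    ∃ N, M ⊆ N ∧ Maximal IsMonotoneSet N := by
  refine zorn_subset_nonempty {N | IsMonotoneSet N} ?_ M hM
  intro c hc hchain _
  refine ⟨⋃₀ c, ?_, fun s hs => subset_sUnion_of_mem hs⟩
  rintro p ⟨s, hs, hps⟩ q ⟨t, ht, hqt⟩
  rcases hchain.total hs ht with h | h
  · exact hc ht p (h hps) q hqt
  · exact hc hs p hps q (h hqt)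

lemma IsMonotoneSet.mem_of_maximal (hM : Maximal IsMonotoneSet M) {p : E × E}
    (hp : ∀ q ∈ M, 0 ≤ ⟪p.1 - q.1, p.2 - q.2⟫) : p ∈ M := by
  have hins : IsMonotoneSet (insert p M) := by
    rintro a (rfl | ha) b (rfl | hb)
    · simp
    · exact hp b hb
    · rw [← neg_sub b.1, ← neg_sub b.2, inner_neg_neg]
      exact hp a ha
    · exact hM.prop a ha b hb
  exact hM.le_of_ge hins (subset_insert p M) (mem_insert p M)

/-- The fibres of a maximal monotone set are convex. -/
lemma IsMonotoneSet.convex_fiber (hM : Maximal IsMonotoneSet M) (x : E) :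
    Convex ℝ {y | (x, y) ∈ M} := by
  intro y hy z hz a b ha hb hab
  refine IsMonotoneSet.mem_of_maximal hM fun q hq => ?_
  have h : a • y + b • z - q.2 = a • (y - q.2) + b • (z - q.2) := by
    rw [smul_sub, smul_sub, sub_add_sub_comm, ← add_smul, hab, one_smul]
  simp only [h, inner_add_right, inner_smul_right]
  have h1 := hM.prop _ hy q hq
  have h2 := hM.prop _ hz q hq
  simp only at h1 h2
  positivity

/-- The Minty parametrization: on a monotone set, `x` is a nonexpansive function of `x + y`. -/
lemma IsMonotoneSet.norm_sub_le (hM : IsMonotoneSet M) {p q : E × E} (hp : p ∈ M) (hq : q ∈ M) :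
    ‖p.1 - q.1‖ ≤ ‖(p.1 + p.2) - (q.1 + q.2)‖ := by
  have h := hM p hp q hq
  have e : (p.1 + p.2) - (q.1 + q.2) = (p.1 - q.1) + (p.2 - q.2) := by abel
  rw [e]
  refine le_of_sq_le_sq ?_ (norm_nonneg _)
  rw [norm_add_sq_real]
  nlinarith [sq_nonneg ‖p.2 - q.2‖]

lemma IsMonotoneSet.exists_lipschitz_resolvent [FiniteDimensional ℝ E] (hM : IsMonotoneSet M) :
    ∃ (R : E → E) (C : ℝ≥0), LipschitzWith C R ∧ ∀ p ∈ M, R (p.1 + p.2) = p.1 := by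
  classical
  let Z : Set E := (fun p : E × E => p.1 + p.2) '' M
  let f : E → E := fun z => if h : z ∈ Z then (Classical.choose h).1 else 0
  have hf : ∀ z (h : z ∈ Z), ∃ p ∈ M, p.1 + p.2 = z ∧ f z = p.1 := fun z h =>
    ⟨Classical.choose h, (Classical.choose_spec h).1, (Classical.choose_spec h).2,
      by simp only [f, dif_pos h]⟩
  have hlip : LipschitzOnWith 1 f Z := by
    refine LipschitzOnWith.of_dist_le_mul fun z hz w hw => ?_
    obtain ⟨p, hp, rfl, hfp⟩ := hf z hz
    obtain ⟨q, hq, rfl, hfq⟩ := hf w hw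
    rw [hfp, hfq, dist_eq_norm, dist_eq_norm, NNReal.coe_one, one_mul]
    exact hM.norm_sub_le hp hq
  obtain ⟨R, hR, hRf⟩ := hlip.extend_finite_dimension
  refine ⟨R, _, hR, fun p hp => ?_⟩
  have hz : p.1 + p.2 ∈ Z := mem_image_of_mem _ hp
  obtain ⟨q, hq, hqz, hfq⟩ := hf _ hz
  rw [← hRf hz, hfq, ← sub_eq_zero, ← norm_le_zero_iff]
  simpa [hqz] using hM.norm_sub_le hq hp

variable [FiniteDimensional ℝ E] [MeasurableSpace E] [BorelSpace E]

lemma LipschitzWith.addHaar_image_eq_zero (μ : Measure E) [μ.IsAddHaarMeasure] {f : E → E}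
    {C : ℝ≥0} (hf : LipschitzWith C f) {s : Set E} (hs : μ s = 0) : μ (f '' s) = 0 := by
  have hs' : μH[Module.finrank ℝ E] s = 0 :=
    Measure.absolutelyContinuous_isAddHaarMeasure _ μ hs
  refine Measure.absolutelyContinuous_isAddHaarMeasure μ μH[Module.finrank ℝ E] ?_
  have h := hf.hausdorffMeasure_image_le (Nat.cast_nonneg (Module.finrank ℝ E)) s
  simpa [hs'] using h

/-- A monotone set is single-valued over almost every point. -/
theorem IsMonotoneSet.addHaar_multivalued_eq_zero (μ : Measure E) [μ.IsAddHaarMeasure]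
    (hM : IsMonotoneSet M) :
    μ {x | ∃ y z, (x, y) ∈ M ∧ (x, z) ∈ M ∧ y ≠ z} = 0 := by
  obtain ⟨N, hMN, hN⟩ := hM.exists_maximal
  obtain ⟨R, C, hR, hRN⟩ := hN.prop.exists_lipschitz_resolvent
  have hnd : μ (R '' {z | ¬ DifferentiableAt ℝ R z}) = 0 :=
    hR.addHaar_image_eq_zero μ hR.ae_differentiableAt
  have hcrit : μ (R '' {z | DifferentiableAt ℝ R z ∧ (fderiv ℝ R z).det = 0}) = 0 :=
    addHaar_image_eq_zero_of_det_fderivWithin_eq_zero μ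
      (fun z hz => hz.1.hasFDerivAt.hasFDerivWithinAt) fun z hz => hz.2
  refine measure_mono_null ?_ (measure_union_null hnd hcrit)
  rintro x ⟨y, z, hy, hz, hyz⟩
  have hx : R (x + y) = x := hRN _ (hMN hy)
  by_cases hd : DifferentiableAt ℝ R (x + y)
  swap
  · exact Or.inl ⟨x + y, hd, hx⟩
  refine Or.inr ⟨x + y, ⟨hd, ?_⟩, hx⟩
  have hconst : ∀ t ∈ Icc (0 : ℝ) 1, R ((x + y) + t • (z - y)) = x := by
    intro t ht
    have h := (IsMonotoneSet.convex_fiber hN x).add_smul_sub_mem (hMN hy) (hMN hz) ht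
    simpa [add_assoc] using hRN _ h
  have hker : fderiv ℝ R (x + y) (z - y) = 0 := by
    have h1 : HasDerivAt (fun t : ℝ => R ((x + y) + t • (z - y))) (fderiv ℝ R (x + y) (z - y)) 0 :=
      hd.hasFDerivAt.hasLineDerivAt (z - y)
    have h2 : HasDerivWithinAt (fun t : ℝ => R ((x + y) + t • (z - y))) 0 (Icc 0 1) 0 :=
      (hasDerivWithinAt_const (0 : ℝ) (Icc (0 : ℝ) 1) x).congr hconst
        (hconst 0 (left_mem_Icc.2 zero_le_one))
    exact (uniqueDiffOn_Icc (zero_lt_one' ℝ) 0 (left_mem_Icc.2 zero_le_one)).eq_deriv _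
      h1.hasDerivWithinAt h2
  by_contra hdet
  refine hyz (sub_eq_zero.1 ?_).symm
  have h := (LinearMap.equivOfDetNeZero _ hdet).map_eq_zero_iff (x := z - y)
  exact h.1 hker

end MonotoneSet

section Coupling

variable {n : ℕ} {γ : Measure (En n × En n)} {μ ν : Measure (En n)}

lemma IsCoupling.isProbabilityMeasure (h : IsCoupling γ ν μ) [IsProbabilityMeasure ν] :
    IsProbabilityMeasure γ := by
  constructor
  rw [← measure_univ (μ := ν), ← h.1, Measure.map_apply measurable_fst .univ, preimage_univ]

lemma IsCoupling.integrable_fst (h : IsCoupling γ ν μ) (hν : FinSecMom ν) :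
    Integrable (fun p : En n × En n => ‖p.1‖ ^ 2) γ := by
  rw [FinSecMom, ← h.1] at hν
  exact hν.comp_measurable measurable_fst

lemma IsCoupling.integrable_snd (h : IsCoupling γ ν μ) (hμ : FinSecMom μ) :
    Integrable (fun p : En n × En n => ‖p.2‖ ^ 2) γ := by
  rw [FinSecMom, ← h.2] at hμ
  exact hμ.comp_measurable measurable_snd

lemma integrable_norm_sub_sq {α E : Type*} [MeasurableSpace α] [NormedAddCommGroup E]
    {π : Measure α} {f g : α → E} (hf : AEStronglyMeasurable f π) (hg : AEStronglyMeasurable g π)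
    (hf2 : Integrable (fun a => ‖f a‖ ^ 2) π) (hg2 : Integrable (fun a => ‖g a‖ ^ 2) π) :
    Integrable (fun a => ‖f a - g a‖ ^ 2) π := by
  refine ((hf2.const_mul 2).add (hg2.const_mul 2)).mono' ((hf.sub hg).norm.pow 2)
    (.of_forall fun a => ?_)
  rw [Real.norm_of_nonneg (by positivity), Pi.add_apply]
  nlinarith [norm_sub_le (f a) (g a), norm_nonneg (f a - g a), sq_nonneg (‖f a‖ - ‖g a‖)]

lemma IsCoupling.integrable_cost (h : IsCoupling γ ν μ) (hν : FinSecMom ν) (hμ : FinSecMom μ) :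
    Integrable (fun p : En n × En n => ‖p.1 - p.2‖ ^ 2) γ :=
  integrable_norm_sub_sq measurable_fst.aestronglyMeasurable measurable_snd.aestronglyMeasurable
    (h.integrable_fst hν) (h.integrable_snd hμ)

lemma bddBelow_costs :
    BddBelow {c | ∃ γ : Measure (En n × En n), IsCoupling γ ν μ ∧
      c = ∫ p, ‖p.1 - p.2‖ ^ 2 ∂γ} := by
  refine ⟨0, ?_⟩
  rintro _ ⟨γ, -, rfl⟩
  positivity

lemma IsCoupling.W2sq_le (h : IsCoupling γ ν μ) : W2sq ν μ ≤ ∫ p, ‖p.1 - p.2‖ ^ 2 ∂γ :=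
  csInf_le bddBelow_costs ⟨γ, h, rfl⟩

/-- The set of pairs of points of `ℝⁿ × ℝⁿ` violating monotonicity. -/
def crossingSet (n : ℕ) : Set ((En n × En n) × (En n × En n)) :=
  {p | ⟪p.1.1 - p.2.1, p.1.2 - p.2.2⟫ < 0}

lemma isOpen_crossingSet : IsOpen (crossingSet n) :=
  isOpen_lt (by fun_prop) continuous_const

lemma swap_mem_crossingSet {p : (En n × En n) × (En n × En n)} :
    p.swap ∈ crossingSet n ↔ p ∈ crossingSet n := by
  simp only [crossingSet, mem_ofPred_eq, Prod.fst_swap, Prod.snd_swap]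
  rw [← neg_sub p.1.1, ← neg_sub p.1.2, inner_neg_neg]

open Classical in
/-- Given two points `(x, y)` and `(x', y')`, the pair `(x, y')` if they cross and `(x, y)`
otherwise. -/
def uncross (p : (En n × En n) × (En n × En n)) : En n × En n :=
  (p.1.1, if p ∈ crossingSet n then p.2.2 else p.1.2)

lemma measurable_uncross : Measurable (uncross (n := n)) := by
  classical
  refine Measurable.prodMk (by fun_prop) ?_
  exact Measurable.ite isOpen_crossingSet.measurableSet (by fun_prop) (by fun_prop)

/-- Exchanging the targets of independent crossing pairs does not change the marginals. -/
lemma IsCoupling.map_uncross (h : IsCoupling γ ν μ) [IsProbabilityMeasure γ] :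
    IsCoupling ((γ.prod γ).map uncross) ν μ := by
  classical
  constructor
  · rw [Measure.map_map measurable_fst measurable_uncross]
    have e : Prod.fst ∘ uncross (n := n) = Prod.fst ∘ Prod.fst := rfl
    rw [e, ← Measure.map_map measurable_fst measurable_fst, ← h.1]
    congr 1
    exact measurePreserving_fst.map_eq
  · rw [Measure.map_map measurable_snd measurable_uncross]
    have hmarg : (γ.prod γ).map (fun p => p.1.2) = μ := by
      have e : (fun p : (En n × En n) × (En n × En n) => p.1.2) = Prod.snd ∘ Prod.fst := rfl
      rw [e, ← Measure.map_map measurable_snd measurable_fst, ← h.2]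
      congr 1
      exact measurePreserving_fst.map_eq
    have hS : MeasurableSet (crossingSet n) := isOpen_crossingSet.measurableSet
    rw [← hmarg]
    ext B hB
    have hB1 : MeasurableSet {p : (En n × En n) × (En n × En n) | p.1.2 ∈ B} :=
      (measurable_snd.comp measurable_fst) hB
    rw [Measure.map_apply (measurable_snd.comp measurable_uncross) hB,
      Measure.map_apply (by fun_prop) hB]
    rw [← measure_inter_add_sdiff _ hS, ← measure_inter_add_sdiff ((fun p => p.1.2) ⁻¹' B) hS]
    congr 1
    · refine Eq.trans ?_ ((Measure.measurePreserving_swap (μ := γ) (ν := γ)).measure_preimage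
        (hB1.inter hS).nullMeasurableSet)
      congr 1
      ext p
      have hsw := swap_mem_crossingSet (p := p)
      by_cases hp : p ∈ crossingSet n <;> simp [uncross, hp, hsw]
    · congr 1
      ext p
      by_cases hp : p ∈ crossingSet n <;> simp [uncross, hp]

/-- Almost no two points of an optimal coupling cross. -/
lemma IsCoupling.measure_crossingSet_eq_zero (h : IsCoupling γ ν μ) [IsProbabilityMeasure γ]
    (hν : FinSecMom ν) (hμ : FinSecMom μ) (hopt : ∫ p, ‖p.1 - p.2‖ ^ 2 ∂γ ≤ W2sq ν μ) :
    (γ.prod γ) (crossingSet n) = 0 := by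
  classical
  have hS : MeasurableSet (crossingSet n) := isOpen_crossingSet.measurableSet
  have hcost := h.integrable_cost hν hμ
  have hpf : MeasurePreserving Prod.fst (γ.prod γ) γ := measurePreserving_fst
  have hps : MeasurePreserving Prod.snd (γ.prod γ) γ := measurePreserving_snd
  have hsw : MeasurePreserving Prod.swap (γ.prod γ) (γ.prod γ) := Measure.measurePreserving_swap
  have hI : ∫ p, ‖p.1.1 - p.1.2‖ ^ 2 ∂(γ.prod γ) = ∫ p, ‖p.1 - p.2‖ ^ 2 ∂γ := by
    rw [← hpf.map_eq, integral_map measurable_fst.aemeasurable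
      (by rw [hpf.map_eq]; exact hcost.aestronglyMeasurable), hpf.map_eq]
  have hi1 : Integrable (fun p => ‖p.1.1 - p.1.2‖ ^ 2) (γ.prod γ) :=
    hpf.integrable_comp_of_integrable hcost
  have hi2 : Integrable (fun p => ‖p.1.1 - p.2.2‖ ^ 2) (γ.prod γ) :=
    integrable_norm_sub_sq (by fun_prop) (by fun_prop)
      (hpf.integrable_comp_of_integrable (h.integrable_fst hν))
      (hps.integrable_comp_of_integrable (h.integrable_snd hμ))
  let D : (En n × En n) × (En n × En n) → ℝ :=
    (crossingSet n).indicator fun p => ‖p.1.1 - p.2.2‖ ^ 2 - ‖p.1.1 - p.1.2‖ ^ 2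
  have hD : Integrable D (γ.prod γ) := (hi2.sub hi1).indicator hS
  have hDnonneg : 0 ≤ ∫ p, D p ∂(γ.prod γ) := by
    have hle := hopt.trans h.map_uncross.W2sq_le
    rw [integral_map measurable_uncross.aemeasurable (by fun_prop), ← hI] at hle
    have e : (fun p : (En n × En n) × (En n × En n) => ‖(uncross p).1 - (uncross p).2‖ ^ 2)
        = fun p => ‖p.1.1 - p.1.2‖ ^ 2 + D p := by
      ext p
      by_cases hp : p ∈ crossingSet n <;> simp [uncross, D, hp]
    rw [e, integral_add hi1 hD] at hle
    linarith
  have hsum : ∀ p, D p + D p.swap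
      = (crossingSet n).indicator (fun p => 2 * ⟪p.1.1 - p.2.1, p.1.2 - p.2.2⟫) p := by
    intro p
    have hsw := swap_mem_crossingSet (p := p)
    by_cases hp : p ∈ crossingSet n
    · simp only [D, indicator_of_mem hp, indicator_of_mem (hsw.2 hp), Prod.fst_swap, Prod.snd_swap]
      simp only [norm_sub_sq_real, inner_sub_left, inner_sub_right]
      ring
    · simp [D, hp, hsw]
  have hDs : Integrable (fun p : (En n × En n) × (En n × En n) => D p.swap) (γ.prod γ) :=
    hsw.integrable_comp_of_integrable hD
  have hDsI : ∫ p, D p.swap ∂(γ.prod γ) = ∫ p, D p ∂(γ.prod γ) :=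
    hsw.integral_comp MeasurableEquiv.prodComm.measurableEmbedding D
  have hneg : ∀ p, 0 ≤ -(D p + D p.swap) := by
    intro p
    rw [hsum]
    by_cases hp : p ∈ crossingSet n
    · rw [indicator_of_mem hp]
      have : ⟪p.1.1 - p.2.1, p.1.2 - p.2.2⟫ < 0 := hp
      linarith
    · simp [hp]
  have hzero : ∫ p, -(D p + D p.swap) ∂(γ.prod γ) = 0 := by
    refine le_antisymm ?_ (integral_nonneg hneg)
    rw [integral_neg, integral_add hD hDs, hDsI]
    linarith
  have hae := (integral_eq_zero_iff_of_nonneg hneg (hD.add hDs).neg).1 hzero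
  rw [measure_eq_zero_iff_ae_notMem]
  filter_upwards [hae] with p hp0 hp
  have h1 : ⟪p.1.1 - p.2.1, p.1.2 - p.2.2⟫ < 0 := hp
  simp only [hsum, indicator_of_mem hp, Pi.zero_apply] at hp0
  linarith

lemma IsCoupling.isMonotoneSet_support (h : IsCoupling γ ν μ) [IsProbabilityMeasure γ]
    (hν : FinSecMom ν) (hμ : FinSecMom μ) (hopt : ∫ p, ‖p.1 - p.2‖ ^ 2 ∂γ ≤ W2sq ν μ) :
    IsMonotoneSet γ.support := by
  intro p hp q hq
  by_contra! hneg
  have hnhds : crossingSet n ∈ 𝓝 (p, q) := isOpen_crossingSet.mem_nhds hneg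
  obtain ⟨U, hU, V, hV, hUV⟩ := mem_nhds_prod_iff.1 hnhds
  have h0 := measure_mono_null hUV (h.measure_crossingSet_eq_zero hν hμ hopt)
  rw [Measure.prod_prod] at h0
  exact mul_ne_zero (Measure.mem_support_iff_forall p |>.1 hp U hU).ne'
    (Measure.mem_support_iff_forall q |>.1 hq V hV).ne' h0

end Coupling

section Existence

variable {n : ℕ} {μ ν : Measure (En n)}

lemma lowerSemicontinuous_lintegral_probabilityMeasure {X : Type*} [TopologicalSpace X]
    [MeasurableSpace X] [OpensMeasurableSpace X] {f : X → ℝ≥0} (hf : Continuous f) :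
    LowerSemicontinuous fun γ : ProbabilityMeasure X => ∫⁻ x, f x ∂(γ : Measure X) := by
  let g : ℕ → BoundedContinuousFunction X ℝ≥0 := fun k =>
    .mkOfBound ⟨fun x => min (f x) k, hf.min continuous_const⟩ k fun x y => by
      have h1 : ((min (f x) k : ℝ≥0) : ℝ) ≤ k := by exact_mod_cast min_le_right (f x) (k : ℝ≥0)
      have h2 : ((min (f y) k : ℝ≥0) : ℝ) ≤ k := by exact_mod_cast min_le_right (f y) (k : ℝ≥0)
      change |((min (f x) k : ℝ≥0) : ℝ) - (min (f y) k : ℝ≥0)| ≤ k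
      exact abs_sub_le_of_nonneg_of_le NNReal.zero_le_coe h1 NNReal.zero_le_coe h2
  have hg : ∀ k x, g k x = min (f x) k := fun _ _ => rfl
  have hsup : ∀ x, (f x : ℝ≥0∞) = ⨆ k, (g k x : ℝ≥0∞) := by
    intro x
    obtain ⟨k, hk⟩ := exists_nat_ge (f x)
    refine le_antisymm (le_iSup_of_le k ?_) (iSup_le fun k => ?_)
    · rw [hg, min_eq_left hk]
    · rw [hg]
      exact_mod_cast min_le_left _ _
  have e : (fun γ : ProbabilityMeasure X => ∫⁻ x, f x ∂(γ : Measure X))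
      = fun γ : ProbabilityMeasure X => ⨆ k, ∫⁻ x, g k x ∂(γ : Measure X) := by
    ext γ
    simp_rw [hsup]
    refine lintegral_iSup (fun k => (g k).continuous.measurable.coe_nnreal_ennreal) ?_
    intro k l hkl x
    simp only [hg]
    gcongr
  rw [e]
  exact lowerSemicontinuous_iSup fun k =>
    (ProbabilityMeasure.continuous_lintegral_boundedContinuousFunction (g k)).lowerSemicontinuous

lemma isCompact_couplings (ν μ : ProbabilityMeasure (En n)) :
    IsCompact {γ : ProbabilityMeasure (En n × En n) | IsCoupling (γ : Measure (En n × En n)) ν μ} := by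
  have e : {γ : ProbabilityMeasure (En n × En n) | IsCoupling (γ : Measure (En n × En n)) ν μ}
      = {γ | γ.map measurable_fst.aemeasurable = ν} ∩
        {γ | γ.map measurable_snd.aemeasurable = μ} := by
    ext γ
    simp only [mem_inter_iff, mem_ofPred_eq, IsCoupling,
      ← ProbabilityMeasure.toMeasure_injective.eq_iff, ProbabilityMeasure.toMeasure_map]
  have hclosed : IsClosed
      {γ : ProbabilityMeasure (En n × En n) | IsCoupling (γ : Measure (En n × En n)) ν μ} := by
    rw [e]
    exact (isClosed_eq (ProbabilityMeasure.continuous_map continuous_fst) continuous_const).inter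
      (isClosed_eq (ProbabilityMeasure.continuous_map continuous_snd) continuous_const)
  rw [← hclosed.closure_eq]
  refine isCompact_closure_of_isTightMeasureSet (IsTightMeasureSet.prodMk ?_ ?_)
  · refine (isTightMeasureSet_singleton (μ := (ν : Measure (En n)))).subset ?_
    rintro _ ⟨_, ⟨γ, hγ, rfl⟩, rfl⟩
    exact hγ.1
  · refine (isTightMeasureSet_singleton (μ := (μ : Measure (En n)))).subset ?_
    rintro _ ⟨_, ⟨γ, hγ, rfl⟩, rfl⟩
    exact hγ.2

lemma isCoupling_prod [IsProbabilityMeasure ν] [IsProbabilityMeasure μ] :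
    IsCoupling (ν.prod μ) ν μ :=
  ⟨measurePreserving_fst.map_eq, measurePreserving_snd.map_eq⟩

lemma exists_optimal_coupling [IsProbabilityMeasure ν] [IsProbabilityMeasure μ]
    (hν : FinSecMom ν) (hμ : FinSecMom μ) :
    ∃ γ, IsCoupling γ ν μ ∧ ∫ p, ‖p.1 - p.2‖ ^ 2 ∂γ = W2sq ν μ := by
  have hcont : Continuous fun p : En n × En n => ‖p.1 - p.2‖₊ ^ 2 := by fun_prop
  obtain ⟨γ, hγ, hmin⟩ := LowerSemicontinuousOn.exists_isMinOn
    ⟨⟨ν.prod μ, inferInstance⟩, isCoupling_prod⟩ (isCompact_couplings ⟨ν, ‹_›⟩ ⟨μ, ‹_›⟩)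
    (lowerSemicontinuous_lintegral_probabilityMeasure hcont |>.lowerSemicontinuousOn _)
  refine ⟨γ, hγ, Eq.symm <| IsLeast.csInf_eq ⟨⟨γ, hγ, rfl⟩, ?_⟩⟩
  rintro _ ⟨γ', hγ', rfl⟩
  have hγ'p := hγ'.isProbabilityMeasure
  have hle := isMinOn_iff.1 hmin ⟨γ', hγ'p⟩ hγ'
  have hcoe : ∀ p : En n × En n, ((‖p.1 - p.2‖₊ ^ 2 : ℝ≥0) : ℝ≥0∞)
      = ENNReal.ofReal (‖p.1 - p.2‖ ^ 2) := fun p => by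
    rw [← ENNReal.ofReal_coe_nnreal]
    simp
  simp only [hcoe, ProbabilityMeasure.coe_mk] at hle
  have hγi := IsCoupling.integrable_cost hγ hν hμ
  have hγ'i := hγ'.integrable_cost hν hμ
  rw [← ofReal_integral_eq_lintegral_ofReal hγi (.of_forall fun p => by positivity),
    ← ofReal_integral_eq_lintegral_ofReal hγ'i (.of_forall fun p => by positivity)] at hle
  exact (ENNReal.ofReal_le_ofReal_iff (by positivity)).1 hle

end Existence

section Graph

variable {n : ℕ}

/-- A measure concentrated on a closed set which is single-valued over almost every point is
determined by its first marginal. -/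
lemma map_snd_eq_of_isClosed_of_singleValued {γ γ' : Measure (En n × En n)} {ν : Measure (En n)}
    [IsFiniteMeasure γ] {K : Set (En n × En n)} (hK : IsClosed K)
    (hγ : γ.map Prod.fst = ν) (hγ' : γ'.map Prod.fst = ν) (hγK : γ Kᶜ = 0) (hγ'K : γ' Kᶜ = 0)
    (hν : ν {x | ∃ y z, (x, y) ∈ K ∧ (x, z) ∈ K ∧ y ≠ z} = 0) :
    γ.map Prod.snd = γ'.map Prod.snd := by
  have key : ∀ B : Set (En n), IsClosed B → ∀ π : Measure (En n × En n), π.map Prod.fst = ν →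
      π Kᶜ = 0 → π.map Prod.snd B = ν (Prod.fst '' (K ∩ Prod.snd ⁻¹' B)) := by
    rintro B hB π rfl hπK
    have hsc : IsSigmaCompact (Prod.fst '' (K ∩ Prod.snd ⁻¹' B)) :=
      (isSigmaCompact_univ.of_isClosed_subset (hK.inter (hB.preimage continuous_snd))
        (subset_univ _)).image continuous_fst
    have hmeas : MeasurableSet (Prod.fst '' (K ∩ Prod.snd ⁻¹' B)) := by
      obtain ⟨C, hC, hCU⟩ := hsc
      rw [← hCU]
      exact .iUnion fun i => (hC i).measurableSet
    rw [Measure.map_apply measurable_snd hB.measurableSet, Measure.map_apply measurable_fst hmeas]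
    refine measure_congr ?_
    have hsv : ∀ᵐ p ∂π, ¬ ∃ y z, (p.1, y) ∈ K ∧ (p.1, z) ∈ K ∧ y ≠ z :=
      ae_of_ae_map measurable_fst.aemeasurable (measure_eq_zero_iff_ae_notMem.1 hν)
    filter_upwards [hsv, measure_eq_zero_iff_ae_notMem.1 hπK] with p hp hpK
    rw [notMem_compl_iff] at hpK
    refine propext ⟨fun hpB => ⟨p, ⟨hpK, hpB⟩, rfl⟩, ?_⟩
    rintro ⟨q, ⟨hqK, hqB⟩, hq⟩
    by_contra hpB
    refine hp ⟨p.2, q.2, hpK, hq ▸ hqK, fun h => hpB ?_⟩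
    change p.2 ∈ B
    rw [h]
    exact hqB
  have huniv : γ.map Prod.snd univ = γ'.map Prod.snd univ := by
    rw [key univ isClosed_univ γ hγ hγK, key univ isClosed_univ γ' hγ' hγ'K]
  refine ext_of_generate_finite _ ?_ isPiSystem_isClosed (fun B hB => ?_) huniv
  · rw [BorelSpace.measurable_eq (α := En n), borel_eq_generateFrom_isClosed]
  · rw [key B hB γ hγ hγK, key B hB γ' hγ' hγ'K]

end Graph

lemma IsCoupling.mix {n : ℕ} {γ₀ γ₁ : Measure (En n × En n)} {ν μ₀ μ₁ : Measure (En n)}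
    (h₁ : IsCoupling γ₁ ν μ₁) (h₀ : IsCoupling γ₀ ν μ₀) {a b : ℝ≥0∞} (hab : a + b = 1) :
    IsCoupling (a • γ₁ + b • γ₀) ν (a • μ₁ + b • μ₀) := by
  constructor
  · rw [Measure.map_add _ _ measurable_fst, Measure.map_smul, Measure.map_smul, h₁.1, h₀.1,
      ← add_smul, hab, one_smul]
  · rw [Measure.map_add _ _ measurable_snd, Measure.map_smul, Measure.map_smul, h₁.2, h₀.2]

/-- If `ν ∈ P₂(ℝⁿ)` is absolutely continuous with respect to Lebesgue measure,
then `μ ↦ W₂²(ν, μ)` is strictly convex with respect to the linear structure. -/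
theorem stmt1 {n : ℕ} (ν μ₀ μ₁ : Measure (En n))
    [IsProbabilityMeasure ν] [IsProbabilityMeasure μ₀] [IsProbabilityMeasure μ₁]
    (hν : FinSecMom ν) (h0 : FinSecMom μ₀) (h1 : FinSecMom μ₁)
    (hac : ν ≪ volume) (hne : μ₀ ≠ μ₁)
    (s : ℝ) (hs : s ∈ Ioo (0:ℝ) 1) :
    W2sq ν (ENNReal.ofReal s • μ₁ + ENNReal.ofReal (1 - s) • μ₀) <
      s * W2sq ν μ₁ + (1 - s) * W2sq ν μ₀ := by
  obtain ⟨γ₀, hγ₀, hopt₀⟩ := exists_optimal_coupling hν h0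
  obtain ⟨γ₁, hγ₁, hopt₁⟩ := exists_optimal_coupling hν h1
  have hs' : 0 < 1 - s := sub_pos.2 hs.2
  have hab : ENNReal.ofReal s + ENNReal.ofReal (1 - s) = 1 := by
    rw [← ENNReal.ofReal_add hs.1.le hs'.le]
    simp
  have hγ := hγ₁.mix hγ₀ hab
  set γ := ENNReal.ofReal s • γ₁ + ENNReal.ofReal (1 - s) • γ₀ with hγdef
  have hmix : FinSecMom (ENNReal.ofReal s • μ₁ + ENNReal.ofReal (1 - s) • μ₀) :=
    (Integrable.smul_measure h1 ENNReal.ofReal_ne_top).add_measure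
      (Integrable.smul_measure h0 ENNReal.ofReal_ne_top)
  have hcost : ∫ p, ‖p.1 - p.2‖ ^ 2 ∂γ = s * W2sq ν μ₁ + (1 - s) * W2sq ν μ₀ := by
    rw [hγdef, integral_add_measure
      ((hγ₁.integrable_cost hν h1).smul_measure ENNReal.ofReal_ne_top)
      ((hγ₀.integrable_cost hν h0).smul_measure ENNReal.ofReal_ne_top),
      integral_smul_measure, integral_smul_measure, hopt₀, hopt₁,
      ENNReal.toReal_ofReal hs.1.le, ENNReal.toReal_ofReal hs'.le, smul_eq_mul, smul_eq_mul]
  rw [← hcost]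
  refine lt_of_le_of_ne hγ.W2sq_le fun heq => hne ?_
  have := hγ.isProbabilityMeasure
  have := hγ₀.isProbabilityMeasure
  have hmono := hγ.isMonotoneSet_support hν hmix heq.ge
  have hsupp : γ γ.supportᶜ = 0 := Measure.measure_compl_support
  simp only [hγdef, Measure.add_apply, Measure.smul_apply, smul_eq_mul, add_eq_zero, mul_eq_zero,
    ENNReal.ofReal_eq_zero, hs.1.not_ge, hs'.not_ge, false_or] at hsupp
  have h := map_snd_eq_of_isClosed_of_singleValued Measure.isClosed_support hγ₀.1 hγ₁.1
    hsupp.2 hsupp.1 (hac (hmono.addHaar_multivalued_eq_zero volume))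
  rwa [hγ₀.2, hγ₁.2] at h
end
end

section
/- Let t ↦ μ_t be a weakly continuous curve of probability measures supported on a bounded set M ⊆ ℝⁿ, for t ∈ [0,1]. Then the function μ ↦ ∫₀¹ W₂²(μ_t, μ) dt is convex on P₂(ℝⁿ) with respect to the linear structure; if moreover the set {t ∈ [0,1] : μ_t is absolutely continuous with respect to Lebesgue measure} has positive Lebesgue measure, this function is strictly convex. -/
open MeasureTheory Set

noncomputable section

lemma IsClosed.measurableSet_image_fst {X Y : Type*} [TopologicalSpace X] [TopologicalSpace Y]
    [T2Space X] [SigmaCompactSpace X] [SigmaCompactSpace Y] [MeasurableSpace X] [BorelSpace X]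
    {s : Set (X × Y)} (hs : IsClosed s) : MeasurableSet (Prod.fst '' s) := by
  obtain ⟨K, hK, hKs⟩ := (isSigmaCompact_univ.of_isClosed_subset hs (subset_univ s)).image
    continuous_fst
  rw [← hKs]
  exact MeasurableSet.iUnion fun k => (hK k).measurableSet

/-! ### Couplings and their transport cost -/

namespace IsCoupling

variable {n : ℕ} {γ : Measure (En n × En n)} {μ ν : Measure (En n)}

lemma isProbabilityMeasure_s3 [IsProbabilityMeasure μ] (h : IsCoupling γ μ ν) :
    IsProbabilityMeasure γ := by
  have : IsProbabilityMeasure (γ.map Prod.fst) := h.1 ▸ inferInstance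
  exact Measure.isProbabilityMeasure_of_map Prod.fst

lemma prod (μ ν : Measure (En n)) [IsProbabilityMeasure μ] [IsProbabilityMeasure ν] :
    IsCoupling (μ.prod ν) μ ν :=
  ⟨by simp [Measure.map_fst_prod], by simp [Measure.map_snd_prod]⟩

lemma integrable_fst_s3 (h : IsCoupling γ μ ν) (hμ : FinSecMom μ) :
    Integrable (fun p : En n × En n => ‖p.1‖ ^ 2) γ := by
  rw [FinSecMom, ← h.1] at hμ
  exact hμ.comp_measurable measurable_fst

lemma integrable_snd_s3 (h : IsCoupling γ μ ν) (hν : FinSecMom ν) :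
    Integrable (fun p : En n × En n => ‖p.2‖ ^ 2) γ := by
  rw [FinSecMom, ← h.2] at hν
  exact hν.comp_measurable measurable_snd

lemma integrable_cost_s3 (h : IsCoupling γ μ ν) (hμ : FinSecMom μ) (hν : FinSecMom ν) :
    Integrable (fun p : En n × En n => ‖p.1 - p.2‖ ^ 2) γ := by
  refine (((h.integrable_fst_s3 hμ).const_mul 2).add ((h.integrable_snd_s3 hν).const_mul 2)).mono'
    (by fun_prop) (ae_of_all _ fun p => ?_)
  rw [Real.norm_of_nonneg (by positivity)]
  have h1 : ‖p.1 - p.2‖ ≤ ‖p.1‖ + ‖p.2‖ := norm_sub_le _ _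
  have h2 := pow_le_pow_left₀ (norm_nonneg _) h1 2
  simp only [Pi.add_apply]
  nlinarith [sq_nonneg (‖p.1‖ - ‖p.2‖)]

lemma W2sq_le_s3 (h : IsCoupling γ μ ν) : W2sq μ ν ≤ ∫ p, ‖p.1 - p.2‖ ^ 2 ∂γ :=
  csInf_le ⟨0, by rintro c ⟨γ, -, rfl⟩; positivity⟩ ⟨γ, h, rfl⟩

end IsCoupling

lemma W2sq_nonneg {n : ℕ} (μ ν : Measure (En n)) : 0 ≤ W2sq μ ν :=
  Real.sInf_nonneg (by rintro c ⟨γ, -, rfl⟩; positivity)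

lemma lowerSemicontinuous_lintegral_cost (n : ℕ) :
    LowerSemicontinuous fun γ : ProbabilityMeasure (En n × En n) =>
      ∫⁻ p, (‖p.1 - p.2‖₊ ^ 2 : NNReal) ∂(γ : Measure (En n × En n)) := by
  have key (γ : ProbabilityMeasure (En n × En n)) :
      ∫⁻ p, (‖p.1 - p.2‖₊ ^ 2 : NNReal) ∂(γ : Measure (En n × En n)) =
        ⨆ k : ℕ, ∫⁻ p, (min (‖p.1 - p.2‖₊ ^ 2) k : NNReal) ∂(γ : Measure (En n × En n)) := by
    rw [← lintegral_iSup (fun k => by fun_prop)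
      (fun i j hij p => by dsimp only; gcongr)]
    refine lintegral_congr fun p => le_antisymm ?_ (iSup_le fun k => by gcongr; exact min_le_left _ _)
    obtain ⟨k, hk⟩ := exists_nat_ge (‖p.1 - p.2‖₊ ^ 2)
    refine le_iSup_of_le k ?_
    rw [min_eq_left hk]
  simp_rw [key]
  refine lowerSemicontinuous_iSup fun k => Continuous.lowerSemicontinuous ?_
  let f : BoundedContinuousFunction (En n × En n) NNReal :=
    BoundedContinuousFunction.mkOfBound
      ⟨fun p => min (‖p.1 - p.2‖₊ ^ 2) k, by fun_prop⟩ k (fun p q => by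
        rw [NNReal.dist_eq, abs_le]
        have h1 : (min (‖p.1 - p.2‖₊ ^ 2) k : NNReal) ≤ (k : ℝ) := by
          exact_mod_cast min_le_right _ _
        have h2 : (min (‖q.1 - q.2‖₊ ^ 2) k : NNReal) ≤ (k : ℝ) := by
          exact_mod_cast min_le_right _ _
        have h3 := (min (‖p.1 - p.2‖₊ ^ 2) k : NNReal).coe_nonneg
        have h4 := (min (‖q.1 - q.2‖₊ ^ 2) k : NNReal).coe_nonneg
        constructor <;> simp only [ContinuousMap.coe_mk] <;> linarith)
  exact ProbabilityMeasure.continuous_lintegral_boundedContinuousFunction f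

lemma IsCoupling.lintegral_cost_eq {n : ℕ} {γ : Measure (En n × En n)} {μ ν : Measure (En n)}
    (h : IsCoupling γ μ ν) (hμ : FinSecMom μ) (hν : FinSecMom ν) :
    ∫⁻ p, (‖p.1 - p.2‖₊ ^ 2 : NNReal) ∂γ = ENNReal.ofReal (∫ p, ‖p.1 - p.2‖ ^ 2 ∂γ) := by
  rw [ofReal_integral_eq_lintegral_ofReal (h.integrable_cost_s3 hμ hν)
    (ae_of_all _ fun p => by positivity)]
  refine lintegral_congr fun p => ?_
  rw [ENNReal.ofReal, Real.toNNReal_pow (norm_nonneg _), norm_toNNReal]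

/-- The couplings whose first marginal lies in a tight set and whose second marginal is `ν` form a
relatively compact set. -/
lemma isCompact_closure_couplings {n : ℕ} {S : Set (Measure (En n))} (hS : IsTightMeasureSet S)
    (ν : Measure (En n)) [IsFiniteMeasure ν] :
    IsCompact (closure {γ : ProbabilityMeasure (En n × En n) |
      (γ : Measure (En n × En n)).map Prod.fst ∈ S ∧
        (γ : Measure (En n × En n)).map Prod.snd = ν}) := by
  refine isCompact_closure_of_isTightMeasureSet (IsTightMeasureSet.prodMk ?_ ?_)
  · refine hS.subset ?_
    rintro _ ⟨_, ⟨γ, hγ, rfl⟩, rfl⟩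
    exact hγ.1
  · refine (isTightMeasureSet_singleton (μ := ν)).subset ?_
    rintro _ ⟨_, ⟨γ, hγ, rfl⟩, rfl⟩
    exact hγ.2

lemma isClosed_couplings {n : ℕ} {X : Type*} [TopologicalSpace X]
    {f : X → ProbabilityMeasure (En n)} (hf : Continuous f) (ν : Measure (En n))
    [IsProbabilityMeasure ν] :
    IsClosed {q : X × ProbabilityMeasure (En n × En n) |
      IsCoupling (q.2 : Measure (En n × En n)) (f q.1) ν} := by
  let N : ProbabilityMeasure (En n) := ⟨ν, inferInstance⟩
  have h1 := (ProbabilityMeasure.continuous_map (continuous_fst (X := En n) (Y := En n)))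
  have h2 := (ProbabilityMeasure.continuous_map (continuous_snd (X := En n) (Y := En n)))
  have e : {q : X × ProbabilityMeasure (En n × En n) |
      IsCoupling (q.2 : Measure (En n × En n)) (f q.1) ν} =
      {q | q.2.map continuous_fst.measurable.aemeasurable = f q.1} ∩
        {q | q.2.map continuous_snd.measurable.aemeasurable = N} := by
    ext q
    exact ⟨fun h => ⟨Subtype.ext h.1, Subtype.ext h.2⟩,
      fun h => ⟨congrArg Subtype.val h.1, congrArg Subtype.val h.2⟩⟩
  rw [e]
  exact (isClosed_eq (h1.comp continuous_snd) (hf.comp continuous_fst)).inter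
    (isClosed_eq (h2.comp continuous_snd) continuous_const)

/-- Existence of optimal couplings. -/
lemma exists_isCoupling_W2sq_eq {n : ℕ} {μ ν : Measure (En n)} [IsProbabilityMeasure μ]
    [IsProbabilityMeasure ν] (hμ : FinSecMom μ) (hν : FinSecMom ν) :
    ∃ γ, IsCoupling γ μ ν ∧ W2sq μ ν = ∫ p, ‖p.1 - p.2‖ ^ 2 ∂γ := by
  let N : ProbabilityMeasure (En n) := ⟨μ, inferInstance⟩
  let C : Set (ProbabilityMeasure (En n × En n)) :=
    {γ | IsCoupling (γ : Measure (En n × En n)) μ ν}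
  have hC : IsClosed C :=
    (isClosed_couplings (X := Unit) (f := fun _ => N) continuous_const ν).preimage
      (Continuous.prodMk_right ())
  have hcomp : IsCompact C :=
    (isCompact_closure_couplings (isTightMeasureSet_singleton (μ := μ)) ν).of_isClosed_subset hC
      (fun γ hγ => subset_closure hγ)
  obtain ⟨γ, hγ, hmin⟩ := ((lowerSemicontinuous_lintegral_cost n).lowerSemicontinuousOn
    C).exists_isMinOn ⟨⟨μ.prod ν, inferInstance⟩, IsCoupling.prod μ ν⟩ hcomp
  refine ⟨γ, hγ, le_antisymm hγ.W2sq_le_s3 (le_csInf ⟨_, _, IsCoupling.prod μ ν, rfl⟩ ?_)⟩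
  rintro c ⟨γ', hγ', rfl⟩
  have := hγ'.isProbabilityMeasure_s3
  have h : ∫⁻ p, (‖p.1 - p.2‖₊ ^ 2 : NNReal) ∂(γ : Measure (En n × En n)) ≤
      ∫⁻ p, (‖p.1 - p.2‖₊ ^ 2 : NNReal) ∂γ' := isMinOn_iff.1 hmin ⟨γ', this⟩ hγ'
  rw [hγ.lintegral_cost_eq hμ hν, hγ'.lintegral_cost_eq hμ hν] at h
  exact (ENNReal.ofReal_le_ofReal_iff (by positivity)).1 h

/-! ### Integrability of the Wasserstein distance along a curve -/

lemma finSecMom_of_isBounded {n : ℕ} {M : Set (En n)} (hM : Bornology.IsBounded M)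
    {μ : Measure (En n)} [IsProbabilityMeasure μ] (h : μ Mᶜ = 0) : FinSecMom μ := by
  obtain ⟨R, hR⟩ := hM.exists_norm_le
  refine Integrable.of_bound (C := R ^ 2) (by fun_prop) ?_
  filter_upwards [mem_ae_iff.2 h] with x hx
  rw [Real.norm_of_nonneg (by positivity)]
  exact pow_le_pow_left₀ (norm_nonneg _) (hR x hx) 2

lemma isClosed_W2sq_le {n : ℕ} {X : Type*} [TopologicalSpace X] [CompactSpace X] [T2Space X]
    {f : X → ProbabilityMeasure (En n)} (hf : Continuous f)
    (hf2 : ∀ x, FinSecMom (f x : Measure (En n)))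
    (htight : IsTightMeasureSet (range fun x => (f x : Measure (En n))))
    {ν : Measure (En n)} [IsProbabilityMeasure ν] (hν : FinSecMom ν) (c : ℝ) :
    IsClosed {x | W2sq (f x : Measure (En n)) ν ≤ c} := by
  obtain hc | hc := lt_or_ge c 0
  · convert isClosed_empty
    exact eq_empty_of_forall_notMem fun x hx => (hc.trans_le (W2sq_nonneg _ _)).not_ge hx
  let K := closure {γ : ProbabilityMeasure (En n × En n) |
      (γ : Measure (En n × En n)).map Prod.fst ∈ range (fun x => (f x : Measure (En n))) ∧
        (γ : Measure (En n × En n)).map Prod.snd = ν}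
  have hK : IsCompact K := isCompact_closure_couplings htight ν
  have hcl : IsClosed ({q : X × ProbabilityMeasure (En n × En n) |
      IsCoupling (q.2 : Measure (En n × En n)) (f q.1) ν} ∩
      {q | ∫⁻ p, (‖p.1 - p.2‖₊ ^ 2 : NNReal) ∂(q.2 : Measure (En n × En n)) ≤
        ENNReal.ofReal c}) :=
    (isClosed_couplings hf ν).inter
      (((lowerSemicontinuous_lintegral_cost n).isClosed_preimage _).preimage continuous_snd)
  have hproj : IsClosed (Prod.fst '' (_ ∩ _)) :=
    (IsCompact.of_isClosed_subset (isCompact_univ.prod hK) hcl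
      (fun q hq => ⟨mem_univ _, subset_closure ⟨⟨q.1, hq.1.1.symm⟩, hq.1.2⟩⟩)).image
        continuous_fst |>.isClosed
  convert hproj using 1
  ext x
  constructor
  · intro hx
    obtain ⟨γ, hγ, he⟩ := exists_isCoupling_W2sq_eq (hf2 x) hν
    refine ⟨(x, ⟨γ, hγ.isProbabilityMeasure_s3⟩), ⟨hγ, ?_⟩, rfl⟩
    change ∫⁻ p, (‖p.1 - p.2‖₊ ^ 2 : NNReal) ∂γ ≤ ENNReal.ofReal c
    rw [hγ.lintegral_cost_eq (hf2 x) hν, ← he]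
    exact ENNReal.ofReal_le_ofReal hx
  · rintro ⟨⟨x, γ⟩, ⟨hγ, hc'⟩, rfl⟩
    change IsCoupling (γ : Measure (En n × En n)) (f x) ν at hγ
    change ∫⁻ p, (‖p.1 - p.2‖₊ ^ 2 : NNReal) ∂(γ : Measure (En n × En n)) ≤
      ENNReal.ofReal c at hc'
    rw [hγ.lintegral_cost_eq (hf2 x) hν, ENNReal.ofReal_le_ofReal_iff hc] at hc'
    exact hγ.W2sq_le_s3.trans hc'

lemma integrableOn_W2sq {n : ℕ} {M : Set (En n)} (hM : Bornology.IsBounded M)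
    {μ : ℝ → Measure (En n)} (hprob : ∀ t ∈ Icc (0:ℝ) 1, IsProbabilityMeasure (μ t))
    (hsupp : ∀ t ∈ Icc (0:ℝ) 1, μ t Mᶜ = 0) (hcont : WeakContOn μ (Icc 0 1))
    {ν : Measure (En n)} [IsProbabilityMeasure ν] (hν : FinSecMom ν) :
    IntegrableOn (fun t => W2sq (μ t) ν) (Icc (0:ℝ) 1) := by
  obtain ⟨R, hR⟩ := hM.exists_norm_le
  have hmom (t) (ht : t ∈ Icc (0:ℝ) 1) : FinSecMom (μ t) :=
    have := hprob t ht
    finSecMom_of_isBounded hM (hsupp t ht)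
  have hmeas : AEMeasurable (fun t => W2sq (μ t) ν) (volume.restrict (Icc (0:ℝ) 1)) := by
    refine aemeasurable_restrict_of_measurable_subtype measurableSet_Icc
      (measurable_of_Iic fun c => IsClosed.measurableSet ?_)
    let f : Icc (0:ℝ) 1 → ProbabilityMeasure (En n) := fun t => ⟨μ t, hprob t t.2⟩
    refine isClosed_W2sq_le (f := f) ?_ (fun t => hmom t t.2) ?_ hν c
    · exact ProbabilityMeasure.continuous_iff_forall_continuous_integral.2
        fun g => (hcont g).domRestrict
    · rw [isTightMeasureSet_iff_exists_isCompact_measure_compl_le]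
      refine fun ε _ => ⟨Metric.closedBall 0 R, isCompact_closedBall 0 R, ?_⟩
      rintro _ ⟨t, rfl⟩
      refine (measure_mono_null ?_ (hsupp t t.2)).trans_le zero_le
      exact compl_subset_compl.2 fun x hx => by simpa using hR x hx
  refine Integrable.of_bound hmeas.aestronglyMeasurable (2 * R ^ 2 + 2 * ∫ x, ‖x‖ ^ 2 ∂ν)
    ((ae_restrict_iff' measurableSet_Icc).2 (ae_of_all _ fun t ht => ?_))
  have := hprob t ht
  rw [Real.norm_of_nonneg (W2sq_nonneg _ _)]
  have h := IsCoupling.prod (μ t) ν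
  calc W2sq (μ t) ν ≤ ∫ p, ‖p.1 - p.2‖ ^ 2 ∂((μ t).prod ν) := h.W2sq_le_s3
    _ ≤ ∫ p, (2 * R ^ 2 + 2 * ‖p.2‖ ^ 2) ∂((μ t).prod ν) := by
      refine integral_mono_ae (h.integrable_cost_s3 (hmom t ht) hν)
        ((integrable_const _).add ((h.integrable_snd_s3 hν).const_mul 2)) ?_
      have h0 : ∀ᵐ x ∂((μ t).prod ν).map Prod.fst, x ∈ M := by
        rw [h.1]; exact mem_ae_iff.2 (hsupp t ht)
      filter_upwards [ae_of_ae_map measurable_fst.aemeasurable h0] with p hp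
      have h1 := pow_le_pow_left₀ (norm_nonneg _) (norm_sub_le p.1 p.2) 2
      have h2 := pow_le_pow_left₀ (norm_nonneg _) (hR p.1 hp) 2
      nlinarith [sq_nonneg (‖p.1‖ - ‖p.2‖)]
    _ = 2 * R ^ 2 + 2 * ∫ x, ‖x‖ ^ 2 ∂ν := by
      have hν' : ∫ p, ‖p.2‖ ^ 2 ∂((μ t).prod ν) = ∫ x, ‖x‖ ^ 2 ∂ν := by
        conv_rhs => rw [← h.2]
        rw [integral_map measurable_snd.aemeasurable (by fun_prop)]
      rw [integral_add (integrable_const _) ((h.integrable_snd_s3 hν).const_mul 2),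
        integral_const_mul 2 fun p : En n × En n => ‖p.2‖ ^ 2, hν']
      simp

/-! ### Monotonicity of optimal couplings -/

/-- Two independent draws from an optimal coupling are almost surely in monotone position. -/
lemma IsCoupling.ae_monotone_of_optimal {n : ℕ} {γ : Measure (En n × En n)}
    {μ ν : Measure (En n)} [IsProbabilityMeasure μ] [IsProbabilityMeasure ν]
    (hγ : IsCoupling γ μ ν) (hμ : FinSecMom μ) (hν : FinSecMom ν)
    (hopt : W2sq μ ν = ∫ p, ‖p.1 - p.2‖ ^ 2 ∂γ) :
    ∀ᵐ q ∂(γ.prod γ), 0 ≤ inner ℝ (q.1.1 - q.2.1) (q.1.2 - q.2.2) := by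
  classical
  have := hγ.isProbabilityMeasure_s3
  set A : Set ((En n × En n) × (En n × En n)) :=
    {q | inner ℝ (q.1.1 - q.2.1) (q.1.2 - q.2.2) < 0} with hA_def
  have hA : MeasurableSet A := measurableSet_lt (by fun_prop) measurable_const
  have hswapA (q) : q.swap ∈ A ↔ q ∈ A := by
    simp only [hA_def, mem_ofPred_eq, Prod.fst_swap, Prod.snd_swap]
    rw [← neg_sub q.1.1, ← neg_sub q.1.2, inner_neg_neg]
  have hswap : MeasurePreserving Prod.swap (γ.prod γ) (γ.prod γ) := Measure.measurePreserving_swap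
  have hfst : (γ.prod γ).map Prod.fst = γ := by simp [Measure.map_fst_prod]
  let Ψ : (En n × En n) × (En n × En n) → (En n × En n) × (En n × En n) :=
    A.piecewise Prod.swap id
  have hΨm : Measurable Ψ := measurable_swap.piecewise hA measurable_id
  have hΨ : (γ.prod γ).map Ψ = γ.prod γ := by
    ext B hB
    rw [Measure.map_apply hΨm hB, ← measure_inter_add_sdiff _ hA, ← measure_inter_add_sdiff B hA]
    congr 1
    · rw [← hswap.measure_preimage (hB.inter hA).nullMeasurableSet]
      congr 1
      ext q
      simp only [mem_inter_iff, mem_preimage, hswapA]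
      refine and_congr_left fun hq => ?_
      simp [Ψ, piecewise_eq_of_mem _ _ _ hq]
    · congr 1
      ext q
      refine and_congr_left fun hq => ?_
      simp [Ψ, piecewise_eq_of_notMem _ _ _ hq]
  let Φ : (En n × En n) × (En n × En n) → En n × En n := fun q => (q.1.1, (Ψ q).1.2)
  have hΦm : Measurable Φ := by fun_prop
  have hΦ : IsCoupling ((γ.prod γ).map Φ) μ ν := by
    constructor
    · rw [Measure.map_map measurable_fst hΦm, ← hγ.1]
      conv_rhs => rw [← hfst, Measure.map_map measurable_fst measurable_fst]
      rfl
    · rw [Measure.map_map measurable_snd hΦm, ← hγ.2]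
      conv_rhs => rw [← hfst, ← hΨ, Measure.map_map measurable_fst hΨm,
        Measure.map_map measurable_snd (measurable_fst.comp hΨm)]
      rfl
  have hi := hγ.integrable_cost_s3 hμ hν
  have hi1 : Integrable (fun q : (En n × En n) × (En n × En n) => ‖q.1.1 - q.1.2‖ ^ 2)
      (γ.prod γ) := (hfst.symm ▸ hi).comp_measurable measurable_fst
  have hi2 : Integrable (fun q => ‖(Φ q).1 - (Φ q).2‖ ^ 2) (γ.prod γ) :=
    (hΦ.integrable_cost_s3 hμ hν).comp_measurable hΦm
  let D : (En n × En n) × (En n × En n) → ℝ :=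
    fun q => ‖q.1.1 - q.1.2‖ ^ 2 - ‖(Φ q).1 - (Φ q).2‖ ^ 2
  have hD : Integrable D (γ.prod γ) := hi1.sub hi2
  have hD0 : ∫ q, D q ∂(γ.prod γ) ≤ 0 := by
    rw [integral_sub hi1 hi2, sub_nonpos]
    have h1 : ∫ q, ‖q.1.1 - q.1.2‖ ^ 2 ∂(γ.prod γ) = W2sq μ ν := by
      rw [hopt]
      conv_rhs => rw [← hfst]
      rw [integral_map measurable_fst.aemeasurable (by fun_prop)]
    have h2 := hΦ.W2sq_le_s3
    rw [integral_map hΦm.aemeasurable (by fun_prop)] at h2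
    exact h1.trans_le h2
  have hDs : Integrable (fun q => D q.swap) (γ.prod γ) := hD.swap
  have hDs0 : ∫ q, D q.swap ∂(γ.prod γ) = ∫ q, D q ∂(γ.prod γ) := integral_prod_swap D
  have hsum_mem (q) (hq : q ∈ A) :
      D q + D q.swap = -2 * inner ℝ (q.1.1 - q.2.1) (q.1.2 - q.2.2) := by
    have hq' := (hswapA q).2 hq
    simp only [D, Φ, Ψ, piecewise_eq_of_mem _ _ _ hq, piecewise_eq_of_mem _ _ _ hq',
      Prod.fst_swap, Prod.swap_swap, norm_sub_sq_real, inner_sub_left, inner_sub_right]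
    ring
  have hsum_notMem (q) (hq : q ∉ A) : D q + D q.swap = 0 := by
    have hq' := (hswapA q).not.2 hq
    simp [D, Φ, Ψ, piecewise_eq_of_notMem _ _ _ hq, piecewise_eq_of_notMem _ _ _ hq']
  have hnonneg : 0 ≤ fun q => D q + D q.swap := by
    intro q
    by_cases hq : q ∈ A
    · have h : inner ℝ (q.1.1 - q.2.1) (q.1.2 - q.2.2) < 0 := hq
      simp only [Pi.zero_apply, hsum_mem q hq]
      linarith
    · exact (hsum_notMem q hq).ge
  have hint : ∫ q, (D q + D q.swap) ∂(γ.prod γ) = 0 := by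
    refine le_antisymm ?_ (integral_nonneg hnonneg)
    rw [integral_add hD hDs, hDs0]
    linarith
  filter_upwards [(integral_eq_zero_iff_of_nonneg hnonneg (hD.add hDs)).1 hint] with q hq
  by_contra! hneg
  have := hsum_mem q hneg
  simp only [Pi.zero_apply] at hq
  linarith

lemma IsCoupling.monotone_support_of_optimal {n : ℕ} {γ : Measure (En n × En n)}
    {μ ν : Measure (En n)} [IsProbabilityMeasure μ] [IsProbabilityMeasure ν]
    (hγ : IsCoupling γ μ ν) (hμ : FinSecMom μ) (hν : FinSecMom ν)
    (hopt : W2sq μ ν = ∫ p, ‖p.1 - p.2‖ ^ 2 ∂γ) {p q : En n × En n} (hp : p ∈ γ.support)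
    (hq : q ∈ γ.support) : 0 ≤ inner ℝ (p.1 - q.1) (p.2 - q.2) := by
  have := hγ.isProbabilityMeasure_s3
  by_contra! hneg
  have hopen : IsOpen {r : (En n × En n) × (En n × En n) |
      inner ℝ (r.1.1 - r.2.1) (r.1.2 - r.2.2) < 0} := isOpen_lt (by fun_prop) continuous_const
  obtain ⟨U, hU, V, hV, hUV⟩ := mem_nhds_prod_iff.1 (hopen.mem_nhds (show (p, q) ∈ _ from hneg))
  have hpos := ENNReal.mul_pos ((Measure.mem_support_iff_forall p).1 hp U hU).ne'
    ((Measure.mem_support_iff_forall q).1 hq V hV).ne'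
  rw [← Measure.prod_prod] at hpos
  refine hpos.ne' (measure_mono_null (fun r hr => ?_)
    (hγ.ae_monotone_of_optimal hμ hν hopt))
  have h : inner ℝ (r.1.1 - r.2.1) (r.1.2 - r.2.2) < 0 := hUV hr
  exact h.not_ge

open scoped Pointwise in
/-- A closed monotone relation is single-valued Lebesgue-almost everywhere. -/
lemma volume_multivalued_eq_zero_of_monotone {n : ℕ} {Γ : Set (En n × En n)} (hΓ : IsClosed Γ)
    (hmono : ∀ p ∈ Γ, ∀ q ∈ Γ, 0 ≤ inner ℝ (p.1 - q.1) (p.2 - q.2)) :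
    volume {x | ∃ y z, (x, y) ∈ Γ ∧ (x, z) ∈ Γ ∧ y ≠ z} = 0 := by
  let S (i : Fin n) (a b : ℚ) : Set (En n) :=
    {x | ∃ y z, (x, y) ∈ Γ ∧ (x, z) ∈ Γ ∧ y i ≤ a ∧ (b : ℝ) ≤ z i}
  have hsub : {x | ∃ y z, (x, y) ∈ Γ ∧ (x, z) ∈ Γ ∧ y ≠ z} ⊆
      ⋃ (i : Fin n) (a : ℚ) (b : ℚ) (_ : a < b), S i a b := by
    have key {x y z : En n} {i : Fin n} (hy : (x, y) ∈ Γ) (hz : (x, z) ∈ Γ) (hi : y i < z i) :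
        x ∈ ⋃ (i : Fin n) (a : ℚ) (b : ℚ) (_ : a < b), S i a b := by
      obtain ⟨a, ha, ha'⟩ := exists_rat_btwn hi
      obtain ⟨b, hb, hb'⟩ := exists_rat_btwn ha'
      simp only [mem_iUnion]
      exact ⟨i, a, b, by exact_mod_cast hb, y, z, hy, hz, ha.le, hb'.le⟩
    rintro x ⟨y, z, hy, hz, hne⟩
    obtain ⟨i, hi⟩ : ∃ i, y i ≠ z i := by
      by_contra! h
      exact hne (PiLp.ext h)
    obtain h | h := hi.lt_or_gt
    · exact key hy hz h
    · exact key hz hy h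
  refine measure_mono_null hsub ?_
  simp only [measure_iUnion_null_iff]
  intro i a b hab
  have hmeas : MeasurableSet (S i a b) := by
    have hcl : IsClosed {r : En n × En n × En n |
        (r.1, r.2.1) ∈ Γ ∧ (r.1, r.2.2) ∈ Γ ∧ r.2.1 i ≤ a ∧ (b : ℝ) ≤ r.2.2 i} :=
      (hΓ.preimage (f := fun r : En n × En n × En n => (r.1, r.2.1)) (by fun_prop)).inter
        ((hΓ.preimage (f := fun r : En n × En n × En n => (r.1, r.2.2)) (by fun_prop)).inter
        ((isClosed_le (f := fun r : En n × En n × En n => r.2.1 i) (by fun_prop)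
          continuous_const).inter (isClosed_le (g := fun r : En n × En n × En n => r.2.2 i)
            continuous_const (by fun_prop))))
    convert (hcl.measurableSet_image_fst) using 1
    ext x
    simp [S]
  have hlt {x x' : En n} {t : ℝ} (ht : 0 < t) (hx : x ∈ S i a b) (hx' : x' ∈ S i a b)
      (h : x = x' + t • EuclideanSpace.single i 1) : False := by
    obtain ⟨y, -, hy, -, hya, -⟩ := hx
    obtain ⟨-, z, -, hz, -, hzb⟩ := hx'
    have h1 := hmono _ hy _ hz
    simp only [h, add_sub_cancel_left, inner_smul_left, EuclideanSpace.inner_single_left] at h1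
    simp at h1
    have h2 := nonneg_of_mul_nonneg_right h1 ht
    have h3 : (a : ℝ) < b := by exact_mod_cast hab
    linarith
  refine Measure.addHaar_eq_zero_of_disjoint_translates volume
    (fun k : ℕ => (1 / ((k : ℝ) + 1)) • EuclideanSpace.single i 1) ?_ ?_ hmeas
  · refine (Metric.isBounded_closedBall (x := (0 : En n)) (r := 1)).subset ?_
    rintro _ ⟨k, rfl⟩
    simp only [mem_closedBall_zero_iff, norm_smul, PiLp.norm_single, norm_one, mul_one]
    rw [Real.norm_of_nonneg (by positivity), div_le_one (by positivity)]
    linarith [(Nat.cast_nonneg k : (0:ℝ) ≤ k)]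
  · have hdis {k l : ℕ} (hkl : k < l) :
        Disjoint ({(1 / ((k : ℝ) + 1)) • EuclideanSpace.single i (1 : ℝ)} + S i a b)
          ({(1 / ((l : ℝ) + 1)) • EuclideanSpace.single i (1 : ℝ)} + S i a b) := by
      rw [Set.disjoint_left]
      simp only [singleton_add, mem_image]
      rintro _ ⟨x, hx, rfl⟩ ⟨x', hx', he⟩
      have hpos : 0 < 1 / ((k : ℝ) + 1) - 1 / ((l : ℝ) + 1) :=
        sub_pos.2 (Nat.one_div_lt_one_div hkl)
      refine hlt hpos hx' hx ?_
      rw [sub_smul, add_sub, eq_sub_iff_add_eq, add_comm x', he, add_comm]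
    intro k l hkl
    obtain h | h := hkl.lt_or_gt
    · exact hdis h
    · exact (hdis h).symm

/-- Couplings of an absolutely continuous `ρ` carried by a common closed monotone relation have the
same second marginal. -/
lemma IsCoupling.eq_of_monotone {n : ℕ} {Γ : Set (En n × En n)} (hΓ : IsClosed Γ)
    (hmono : ∀ p ∈ Γ, ∀ q ∈ Γ, 0 ≤ inner ℝ (p.1 - q.1) (p.2 - q.2))
    {ρ μ₀ μ₁ : Measure (En n)} (hρ : ρ ≪ volume) [IsProbabilityMeasure μ₀]
    [IsProbabilityMeasure μ₁] {γ₀ γ₁ : Measure (En n × En n)} (h₀ : IsCoupling γ₀ ρ μ₀)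
    (h₁ : IsCoupling γ₁ ρ μ₁) (hΓ₀ : γ₀ Γᶜ = 0) (hΓ₁ : γ₁ Γᶜ = 0) : μ₀ = μ₁ := by
  have key {γ : Measure (En n × En n)} {ν : Measure (En n)} (h : IsCoupling γ ρ ν)
      (hγ : γ Γᶜ = 0) {C : Set (En n)} (hC : IsClosed C) :
      ν C = ρ (Prod.fst '' (Γ ∩ Prod.snd ⁻¹' C)) := by
    have hmeas : MeasurableSet (Prod.fst '' (Γ ∩ Prod.snd ⁻¹' C)) :=
      (hΓ.inter (hC.preimage continuous_snd)).measurableSet_image_fst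
    have hS := hρ (volume_multivalued_eq_zero_of_monotone hΓ hmono)
    rw [← h.1] at hS
    have hS' := ae_of_ae_map measurable_fst.aemeasurable (compl_mem_ae_iff.2 hS)
    rw [← h.1, ← h.2, Measure.map_apply measurable_fst hmeas,
      Measure.map_apply measurable_snd hC.measurableSet]
    refine measure_congr ?_
    filter_upwards [mem_ae_iff.2 hγ, hS'] with p hp hpS
    refine propext ⟨fun hpC => ⟨p, ⟨hp, hpC⟩, rfl⟩, ?_⟩
    rintro ⟨q, ⟨hq, hqC⟩, hqp⟩
    have hqp2 : q.2 = p.2 := by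
      by_contra hne
      exact hpS ⟨q.2, p.2, by rwa [← hqp], hp, hne⟩
    change p.2 ∈ C
    rw [← hqp2]
    exact hqC
  refine ext_of_generate_finite _ (BorelSpace.measurable_eq.trans borel_eq_generateFrom_isClosed)
    isPiSystem_isClosed (fun C hC => ?_) (by simp)
  rw [key h₀ hΓ₀ hC, key h₁ hΓ₁ hC]

/-! ### Convexity of the squared Wasserstein distance along mixtures -/

section Mixture

variable {α : Type*} [MeasurableSpace α]

/-- The mixture `s μ₁ + (1 - s) μ₀`. -/
abbrev mixture (s : ℝ) (μ₀ μ₁ : Measure α) : Measure α :=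
  ENNReal.ofReal s • μ₁ + ENNReal.ofReal (1 - s) • μ₀

lemma isProbabilityMeasure_mixture {s : ℝ} (hs : s ∈ Icc (0:ℝ) 1) (μ₀ μ₁ : Measure α)
    [IsProbabilityMeasure μ₀] [IsProbabilityMeasure μ₁] :
    IsProbabilityMeasure (mixture s μ₀ μ₁) := by
  constructor
  simp only [Measure.add_apply, Measure.smul_apply, measure_univ, smul_eq_mul, mul_one]
  rw [← ENNReal.ofReal_add hs.1 (sub_nonneg.2 hs.2)]
  simp

lemma integrable_mixture {f : α → ℝ} {μ₀ μ₁ : Measure α} (s : ℝ) (h₀ : Integrable f μ₀)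
    (h₁ : Integrable f μ₁) : Integrable f (mixture s μ₀ μ₁) :=
  (h₁.smul_measure ENNReal.ofReal_ne_top).add_measure (h₀.smul_measure ENNReal.ofReal_ne_top)

lemma integral_mixture {f : α → ℝ} {μ₀ μ₁ : Measure α} {s : ℝ} (hs : s ∈ Icc (0:ℝ) 1)
    (h₀ : Integrable f μ₀) (h₁ : Integrable f μ₁) :
    ∫ x, f x ∂(mixture s μ₀ μ₁) = s * ∫ x, f x ∂μ₁ + (1 - s) * ∫ x, f x ∂μ₀ := by
  rw [integral_add_measure (h₁.smul_measure ENNReal.ofReal_ne_top)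
    (h₀.smul_measure ENNReal.ofReal_ne_top), integral_smul_measure, integral_smul_measure,
    ENNReal.toReal_ofReal hs.1, ENNReal.toReal_ofReal (sub_nonneg.2 hs.2), smul_eq_mul,
    smul_eq_mul]

lemma IsCoupling.mixture {n : ℕ} {γ₀ γ₁ : Measure (En n × En n)} {ρ μ₀ μ₁ : Measure (En n)}
    (h₀ : IsCoupling γ₀ ρ μ₀) (h₁ : IsCoupling γ₁ ρ μ₁) {s : ℝ} (hs : s ∈ Icc (0:ℝ) 1) :
    IsCoupling (mixture s γ₀ γ₁) ρ (mixture s μ₀ μ₁) := by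
  constructor
  · rw [Measure.map_add _ _ measurable_fst, Measure.map_smul, Measure.map_smul, h₀.1, h₁.1,
      ← add_smul, ← ENNReal.ofReal_add hs.1 (sub_nonneg.2 hs.2)]
    simp
  · rw [Measure.map_add _ _ measurable_snd, Measure.map_smul, Measure.map_smul, h₀.2, h₁.2]

variable {n : ℕ} {ρ μ₀ μ₁ : Measure (En n)} [IsProbabilityMeasure ρ] [IsProbabilityMeasure μ₀]
  [IsProbabilityMeasure μ₁]

lemma W2sq_mixture_le (hρ : FinSecMom ρ) (h₀ : FinSecMom μ₀) (h₁ : FinSecMom μ₁) {s : ℝ}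
    (hs : s ∈ Icc (0:ℝ) 1) :
    W2sq ρ (mixture s μ₀ μ₁) ≤ s * W2sq ρ μ₁ + (1 - s) * W2sq ρ μ₀ := by
  obtain ⟨γ₀, hγ₀, e₀⟩ := exists_isCoupling_W2sq_eq hρ h₀
  obtain ⟨γ₁, hγ₁, e₁⟩ := exists_isCoupling_W2sq_eq hρ h₁
  rw [e₀, e₁, ← integral_mixture hs (hγ₀.integrable_cost_s3 hρ h₀) (hγ₁.integrable_cost_s3 hρ h₁)]
  exact (hγ₀.mixture hγ₁ hs).W2sq_le_s3

lemma W2sq_mixture_lt (hρ : FinSecMom ρ) (hac : ρ ≪ volume) (h₀ : FinSecMom μ₀)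
    (h₁ : FinSecMom μ₁) (hne : μ₀ ≠ μ₁) {s : ℝ} (hs : s ∈ Ioo (0:ℝ) 1) :
    W2sq ρ (mixture s μ₀ μ₁) < s * W2sq ρ μ₁ + (1 - s) * W2sq ρ μ₀ := by
  have hs' := Ioo_subset_Icc_self hs
  refine (W2sq_mixture_le hρ h₀ h₁ hs').lt_of_ne fun heq => hne ?_
  obtain ⟨γ₀, hγ₀, e₀⟩ := exists_isCoupling_W2sq_eq hρ h₀
  obtain ⟨γ₁, hγ₁, e₁⟩ := exists_isCoupling_W2sq_eq hρ h₁
  rw [e₀, e₁,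
    ← integral_mixture hs' (hγ₀.integrable_cost_s3 hρ h₀) (hγ₁.integrable_cost_s3 hρ h₁)] at heq
  have := isProbabilityMeasure_mixture hs' μ₀ μ₁
  have hsupp : mixture s γ₀ γ₁ (mixture s γ₀ γ₁).supportᶜ = 0 := Measure.measure_compl_support
  rw [Measure.add_apply, add_eq_zero, Measure.smul_apply, Measure.smul_apply, smul_eq_mul,
    smul_eq_mul, mul_eq_zero, mul_eq_zero, ENNReal.ofReal_eq_zero, ENNReal.ofReal_eq_zero,
    or_iff_right hs.1.not_ge, or_iff_right (sub_pos.2 hs.2).not_ge] at hsupp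
  exact IsCoupling.eq_of_monotone Measure.isClosed_support
    (fun p hp q hq => (hγ₀.mixture hγ₁ hs').monotone_support_of_optimal hρ
      (integrable_mixture s h₀ h₁) heq hp hq) hac hγ₀ hγ₁ hsupp.2 hsupp.1

end Mixture

/-- the barycenter functional `μ ↦ ∫₀¹ W₂²(μ_t, μ) dt` is convex with respect to
mixtures; it is strictly convex if the set of times `t` at which `μ_t` is absolutely continuous
has positive Lebesgue measure. -/
theorem stmt3 {n : ℕ} (M : Set (En n)) (hM : Bornology.IsBounded M)
    (μ : ℝ → Measure (En n)) (hprob : ∀ t ∈ Icc (0:ℝ) 1, IsProbabilityMeasure (μ t))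
    (hsupp : ∀ t ∈ Icc (0:ℝ) 1, μ t Mᶜ = 0)
    (hcont : WeakContOn μ (Icc 0 1)) :
    (∀ μ₀ μ₁ : Measure (En n), IsProbabilityMeasure μ₀ → IsProbabilityMeasure μ₁ →
      FinSecMom μ₀ → FinSecMom μ₁ → ∀ s ∈ Icc (0:ℝ) 1,
        ∫ t in Icc (0:ℝ) 1,
            W2sq (μ t) (ENNReal.ofReal s • μ₁ + ENNReal.ofReal (1 - s) • μ₀) ≤
          s * (∫ t in Icc (0:ℝ) 1, W2sq (μ t) μ₁) +
            (1 - s) * ∫ t in Icc (0:ℝ) 1, W2sq (μ t) μ₀) ∧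
    (0 < volume {t | t ∈ Icc (0:ℝ) 1 ∧ μ t ≪ volume} →
      ∀ μ₀ μ₁ : Measure (En n), IsProbabilityMeasure μ₀ → IsProbabilityMeasure μ₁ →
        FinSecMom μ₀ → FinSecMom μ₁ → μ₀ ≠ μ₁ → ∀ s ∈ Ioo (0:ℝ) 1,
          ∫ t in Icc (0:ℝ) 1,
              W2sq (μ t) (ENNReal.ofReal s • μ₁ + ENNReal.ofReal (1 - s) • μ₀) <
            s * (∫ t in Icc (0:ℝ) 1, W2sq (μ t) μ₁) +
              (1 - s) * ∫ t in Icc (0:ℝ) 1, W2sq (μ t) μ₀) := by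
  have hmom (t) (ht : t ∈ Icc (0:ℝ) 1) : FinSecMom (μ t) :=
    have := hprob t ht
    finSecMom_of_isBounded hM (hsupp t ht)
  refine ⟨fun μ₀ μ₁ _ _ h₀ h₁ s hs => ?_, fun hpos μ₀ μ₁ _ _ h₀ h₁ hne s hs => ?_⟩
  · have := isProbabilityMeasure_mixture hs μ₀ μ₁
    have i₀ := integrableOn_W2sq hM hprob hsupp hcont h₀
    have i₁ := integrableOn_W2sq hM hprob hsupp hcont h₁
    have i := integrableOn_W2sq hM hprob hsupp hcont (integrable_mixture s h₀ h₁)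
    rw [← integral_const_mul, ← integral_const_mul,
      ← integral_add (i₁.const_mul s) (i₀.const_mul (1 - s))]
    refine setIntegral_mono_on i ((i₁.const_mul s).add (i₀.const_mul (1 - s))) measurableSet_Icc
      fun t ht => ?_
    have := hprob t ht
    exact W2sq_mixture_le (hmom t ht) h₀ h₁ hs
  · have hs' := Ioo_subset_Icc_self hs
    have := isProbabilityMeasure_mixture hs' μ₀ μ₁
    have i₀ := integrableOn_W2sq hM hprob hsupp hcont h₀
    have i₁ := integrableOn_W2sq hM hprob hsupp hcont h₁
    have i := integrableOn_W2sq hM hprob hsupp hcont (integrable_mixture s h₀ h₁)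
    have i' : IntegrableOn (fun t => s * W2sq (μ t) μ₁ + (1 - s) * W2sq (μ t) μ₀) (Icc 0 1) :=
      (i₁.const_mul s).add (i₀.const_mul (1 - s))
    have i'' : IntegrableOn (fun t => s * W2sq (μ t) μ₁ + (1 - s) * W2sq (μ t) μ₀ -
        W2sq (μ t) (mixture s μ₀ μ₁)) (Icc 0 1) := i'.sub i
    rw [← integral_const_mul, ← integral_const_mul,
      ← integral_add (i₁.const_mul s) (i₀.const_mul (1 - s)), ← sub_pos, ← integral_sub i' i,
      integral_pos_iff_support_of_nonneg_ae ?_ i'']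
    · refine hpos.trans_le ((measure_mono (subset_inter (fun t ht => ?_) fun t ht => ht.1)).trans
        (Measure.le_restrict_apply _ _))
      have := hprob t ht.1
      exact (sub_pos.2 (W2sq_mixture_lt (hmom t ht.1) ht.2 h₀ h₁ hne hs)).ne'
    · refine (ae_restrict_iff' measurableSet_Icc).2 (ae_of_all _ fun t ht => ?_)
      have := hprob t ht
      exact sub_nonneg.2 (W2sq_mixture_le (hmom t ht) h₀ h₁ hs')
end
end
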